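/- arXiv:1701.05298 — 2 statements merged into one kernel-verified Lean document; each statement's English description precedes it below -/
import Mathlib

section
/- Let (x, y, μ, λ) ∈ ℝⁿ × E × ℝᵐ × E be a KKT quadruple of problem (P2) such that λ ∈ K. Then (x, μ, λ) is a KKT triple of problem (P1). -/
open scoped RealInnerProductSpace

noncomputable section

/-- A Euclidean Jordan algebra structure on a finite-dimensional real inner
product space `E`: a commutative bilinear product `jmul` with unit, satisfying
the Jordan identity and compatibility with the inner product, together with the
spectral theorem (every element has a spectral decomposition along a Jordan
frame of size `rank`) and the normalization `⟪c, c⟫ = 1` for primitive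
idempotents, which encodes that the inner product is the trace form. -/
structure EJA (E : Type*) [NormedAddCommGroup E] [InnerProductSpace ℝ E]
    [FiniteDimensional ℝ E] where
  jmul : E →ₗ[ℝ] E →ₗ[ℝ] E
  comm : ∀ y z : E, jmul y z = jmul z y
  unit : E
  unit_jmul : ∀ y : E, jmul unit y = y
  jordan : ∀ y z : E, jmul y (jmul (jmul y y) z) = jmul (jmul y y) (jmul y z)
  assoc_inner : ∀ y z w : E, ⟪jmul y z, w⟫ = ⟪y, jmul z w⟫
  rank : ℕ
  spectral : ∀ y : E, ∃ (c : Fin rank → E) (σ : Fin rank → ℝ),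
    (∀ i, jmul (c i) (c i) = c i) ∧
    (∀ i, c i ≠ 0) ∧
    (∀ i, ∀ a b : E, jmul a a = a → jmul b b = b → a ≠ 0 → b ≠ 0 →
      jmul a b = 0 → c i ≠ a + b) ∧
    (∀ i j, i ≠ j → jmul (c i) (c j) = 0) ∧
    (∑ i, c i) = unit ∧
    y = ∑ i, σ i • c i
  inner_primitive : ∀ c : E, jmul c c = c → c ≠ 0 →
    (∀ a b : E, jmul a a = a → jmul b b = b → a ≠ 0 → b ≠ 0 →
      jmul a b = 0 → c ≠ a + b) →
    ⟪c, c⟫ = 1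

namespace EJA

variable {E : Type*} [NormedAddCommGroup E] [InnerProductSpace ℝ E]
  [FiniteDimensional ℝ E]

/-- `c` is an idempotent. -/
def IsIdempotent (J : EJA E) (c : E) : Prop := J.jmul c c = c

/-- `c` is a primitive idempotent. -/
def IsPrimitive (J : EJA E) (c : E) : Prop :=
  J.IsIdempotent c ∧ c ≠ 0 ∧
    ∀ a b : E, J.IsIdempotent a → J.IsIdempotent b → a ≠ 0 → b ≠ 0 →
      J.jmul a b = 0 → c ≠ a + b

/-- A Jordan frame: primitive idempotents, pairwise orthogonal (w.r.t. the
Jordan product), summing to the unit. -/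
def IsJordanFrame (J : EJA E) (c : Fin J.rank → E) : Prop :=
  (∀ i, J.IsPrimitive (c i)) ∧ (∀ i j, i ≠ j → J.jmul (c i) (c j) = 0) ∧
    (∑ i, c i) = J.unit

/-- The symmetric cone: the cone of squares of the algebra. -/
def K (J : EJA E) : Set E := {z : E | ∃ y : E, z = J.jmul y y}

/-- `y` has rank `k`: some spectral decomposition of `y` has exactly `k`
nonzero eigenvalues.  (By uniqueness of eigenvalues this is well-defined.) -/
def HasRank (J : EJA E) (y : E) (k : ℕ) : Prop :=
  ∃ (c : Fin J.rank → E) (σ : Fin J.rank → ℝ),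
    J.IsJordanFrame c ∧ y = ∑ i, σ i • c i ∧
      (Finset.univ.filter (fun i => σ i ≠ 0)).card = k

/-- `t` is an eigenvalue of `y`. -/
def IsEigenvalue (J : EJA E) (y : E) (t : ℝ) : Prop :=
  ∃ (c : Fin J.rank → E) (σ : Fin J.rank → ℝ) (i : Fin J.rank),
    J.IsJordanFrame c ∧ y = ∑ j, σ j • c j ∧ σ i = t

/-- `p` is a nearest point of the symmetric cone `K` to `v`. -/
def IsProj (J : EJA E) (v p : E) : Prop :=
  p ∈ J.K ∧ ∀ z ∈ J.K, ‖v - p‖ ≤ ‖v - z‖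

/-- A (linear subspace that is a) subalgebra. -/
def IsSubalgebra (J : EJA E) (V : Submodule ℝ E) : Prop :=
  ∀ a ∈ V, ∀ b ∈ V, J.jmul a b ∈ V

/-- The algebra is simple: it is not the direct sum of two nonzero
subalgebras. -/
def IsSimple (J : EJA E) : Prop :=
  ¬ ∃ V W : Submodule ℝ E, J.IsSubalgebra V ∧ J.IsSubalgebra W ∧
      V ≠ ⊥ ∧ W ≠ ⊥ ∧ V ⊓ W = ⊥ ∧ V ⊔ W = ⊤

/-- The tangent cone of the convex set `K` at `z`:
the closure of `⋃_{t>0} t (K - z)`. -/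
def tangentCone (J : EJA E) (z : E) : Set E :=
  closure {d : E | ∃ t : ℝ, 0 < t ∧ ∃ k ∈ J.K, d = t • (k - z)}

/-- The lineality space `T_K(z) ∩ (-T_K(z))` of the tangent cone. -/
def linTangent (J : EJA E) (z : E) : Set E :=
  {d : E | d ∈ J.tangentCone z ∧ -d ∈ J.tangentCone z}

/-- The Lagrangian of problem (P1):
`L(x, μ, λ) = f(x) - ⟪h(x), μ⟫ - ⟪g(x), λ⟫`. -/
def lagr {n m : ℕ} (f : EuclideanSpace ℝ (Fin n) → ℝ)
    (h : EuclideanSpace ℝ (Fin n) → EuclideanSpace ℝ (Fin m))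
    (g : EuclideanSpace ℝ (Fin n) → E) (μ : EuclideanSpace ℝ (Fin m)) (lam : E)
    (x : EuclideanSpace ℝ (Fin n)) : ℝ :=
  f x - ⟪h x, μ⟫ - ⟪g x, lam⟫

/-- The Lagrangian of the slack-variable problem (P2), as a function of the
pair `(x, y)`. -/
def lagrSlack (J : EJA E) {n m : ℕ} (f : EuclideanSpace ℝ (Fin n) → ℝ)
    (h : EuclideanSpace ℝ (Fin n) → EuclideanSpace ℝ (Fin m))
    (g : EuclideanSpace ℝ (Fin n) → E) (μ : EuclideanSpace ℝ (Fin m)) (lam : E)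
    (p : EuclideanSpace ℝ (Fin n) × E) : ℝ :=
  f p.1 - ⟪h p.1, μ⟫ - ⟪g p.1 - J.jmul p.2 p.2, lam⟫

/-- `(x, μ, lam)` is a KKT triple of problem (P1). -/
def KKTP1 (J : EJA E) {n m : ℕ} (f : EuclideanSpace ℝ (Fin n) → ℝ)
    (h : EuclideanSpace ℝ (Fin n) → EuclideanSpace ℝ (Fin m))
    (g : EuclideanSpace ℝ (Fin n) → E)
    (x : EuclideanSpace ℝ (Fin n)) (μ : EuclideanSpace ℝ (Fin m)) (lam : E) : Prop :=
  gradient f x - (fderiv ℝ h x).adjoint μ - (fderiv ℝ g x).adjoint lam = 0 ∧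
    lam ∈ J.K ∧ g x ∈ J.K ∧ J.jmul lam (g x) = 0 ∧ h x = 0

/-- `(x, y, μ, lam)` is a KKT quadruple of the slack-variable problem (P2). -/
def KKTP2 (J : EJA E) {n m : ℕ} (f : EuclideanSpace ℝ (Fin n) → ℝ)
    (h : EuclideanSpace ℝ (Fin n) → EuclideanSpace ℝ (Fin m))
    (g : EuclideanSpace ℝ (Fin n) → E)
    (x : EuclideanSpace ℝ (Fin n)) (y : E) (μ : EuclideanSpace ℝ (Fin m))
    (lam : E) : Prop :=
  gradient f x - (fderiv ℝ h x).adjoint μ - (fderiv ℝ g x).adjoint lam = 0 ∧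
    J.jmul lam y = 0 ∧ g x = J.jmul y y ∧ h x = 0

/-- The augmented Lagrangian of the slack-variable problem (P2). -/
def augSlack (J : EJA E) {n m : ℕ} (f : EuclideanSpace ℝ (Fin n) → ℝ)
    (h : EuclideanSpace ℝ (Fin n) → EuclideanSpace ℝ (Fin m))
    (g : EuclideanSpace ℝ (Fin n) → E) (ρ : ℝ) (μ : EuclideanSpace ℝ (Fin m))
    (lam : E) (x : EuclideanSpace ℝ (Fin n)) (y : E) : ℝ :=
  f x - ⟪h x, μ⟫ + ρ / 2 * ‖h x‖ ^ 2 - ⟪g x - J.jmul y y, lam⟫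
    + ρ / 2 * ‖g x - J.jmul y y‖ ^ 2

/-- The augmented Lagrangian of problem (P1), where `P` is the metric
projection onto the symmetric cone `K`. -/
def augSym (J : EJA E) {n m : ℕ} (f : EuclideanSpace ℝ (Fin n) → ℝ)
    (h : EuclideanSpace ℝ (Fin n) → EuclideanSpace ℝ (Fin m))
    (g : EuclideanSpace ℝ (Fin n) → E) (P : E → E) (ρ : ℝ)
    (μ : EuclideanSpace ℝ (Fin m)) (lam : E)
    (x : EuclideanSpace ℝ (Fin n)) : ℝ :=
  f x - ⟪h x, μ⟫ + ρ / 2 * ‖h x‖ ^ 2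
    + 1 / (2 * ρ) * (-‖lam‖ ^ 2 + ‖P (lam - ρ • g x)‖ ^ 2)

end EJA

namespace EJA

variable {E : Type*} [NormedAddCommGroup E] [InnerProductSpace ℝ E]
  [FiniteDimensional ℝ E] (J : EJA E)

/-- The linearized Jordan identity `2 [L(x), L(x ∘ z)] + [L(z), L(x ∘ x)] = 0`. -/
theorem jordan_linearized (x z w : E) :
    (2 : ℝ) • (J.jmul x (J.jmul (J.jmul x z) w) - J.jmul (J.jmul x z) (J.jmul x w)) +
      (J.jmul z (J.jmul (J.jmul x x) w) - J.jmul (J.jmul x x) (J.jmul z w)) = 0 := by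
  have hplus := J.jordan (x + z) w
  have hminus := J.jordan (x - z) w
  have hz := J.jordan z w
  simp only [map_add, map_sub, LinearMap.add_apply, LinearMap.sub_apply, J.comm z x]
    at hplus hminus
  linear_combination (norm := module) (1 / 2 : ℝ) • hplus - (1 / 2 : ℝ) • hminus - hz

variable {J}

/-- The Peirce polynomial identity `2 L(c)³ - 3 L(c)² + L(c) = 0` for an idempotent `c`. -/
theorem IsIdempotent.peirce {c : E} (hc : J.IsIdempotent c) (v : E) :
    (2 : ℝ) • J.jmul c (J.jmul c (J.jmul c v)) - (3 : ℝ) • J.jmul c (J.jmul c v)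
      + J.jmul c v = 0 := by
  have hlin := J.jordan_linearized c v c
  have hcc : J.jmul c c = c := hc
  rw [hcc, J.comm (J.jmul c v) c, hcc, J.comm v c] at hlin
  linear_combination (norm := module) hlin

/-- Multiplication by an idempotent is positive semidefinite, by an explicit sum of squares. -/
theorem IsIdempotent.inner_jmul_eq {c : E} (hc : J.IsIdempotent c) (v : E) :
    ⟪J.jmul c v, v⟫ =
      ‖J.jmul c v‖ ^ 2 + 4 * ‖J.jmul c v - J.jmul c (J.jmul c v)‖ ^ 2 := by
  have hsymm (a b : E) : ⟪J.jmul c a, b⟫ = ⟪a, J.jmul c b⟫ := by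
    rw [J.comm, J.assoc_inner]
  have h₁ := congrArg (fun u => ⟪v, u⟫) (hc.peirce v)
  have h₂ := congrArg (fun u => ⟪v, u⟫) (hc.peirce (J.jmul c v))
  simp only [inner_add_right, inner_sub_right, inner_smul_right, inner_zero_right] at h₁ h₂
  rw [← real_inner_self_eq_norm_sq, ← real_inner_self_eq_norm_sq]
  simp only [inner_sub_left, inner_sub_right, hsymm]
  linear_combination h₁ - 2 * h₂

theorem IsIdempotent.inner_jmul_nonneg {c : E} (hc : J.IsIdempotent c) (v : E) :
    0 ≤ ⟪J.jmul c v, v⟫ := by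
  rw [hc.inner_jmul_eq]
  positivity

theorem IsIdempotent.jmul_eq_zero_of_inner_eq_zero {c : E} (hc : J.IsIdempotent c) {v : E}
    (hv : ⟪J.jmul c v, v⟫ = 0) : J.jmul c v = 0 := by
  rw [hc.inner_jmul_eq] at hv
  have hsq : ‖J.jmul c v‖ ^ 2 = 0 := by
    nlinarith [sq_nonneg ‖J.jmul c v‖, sq_nonneg ‖J.jmul c v - J.jmul c (J.jmul c v)‖]
  simpa using hsq

/-- The Peirce `0`-space of an idempotent is closed under squares. -/
theorem IsIdempotent.jmul_sq_eq_zero {c : E} (hc : J.IsIdempotent c) {y : E}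
    (hy : J.jmul c y = 0) : J.jmul c (J.jmul y y) = 0 := by
  have hlin := J.jordan_linearized c y y
  rw [show J.jmul c c = c from hc, hy] at hlin
  simpa using hlin

/-- Every element of the symmetric cone is a nonnegative combination of idempotents. -/
theorem exists_eq_sum_sq_smul_of_mem_K {z : E} (hz : z ∈ J.K) :
    ∃ (c : Fin J.rank → E) (τ : Fin J.rank → ℝ),
      (∀ i, J.IsIdempotent (c i)) ∧ z = ∑ i, τ i ^ 2 • c i := by
  obtain ⟨u, rfl⟩ := hz
  obtain ⟨c, τ, hidem, -, -, horth, -, hu⟩ := J.spectral u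
  refine ⟨c, τ, hidem, ?_⟩
  rw [hu]
  simp only [map_sum, map_smul, LinearMap.sum_apply, LinearMap.smul_apply]
  refine Finset.sum_congr rfl fun i _ => ?_
  rw [Finset.sum_eq_single i (fun j _ hj => by simp [horth j i hj]) (by simp), hidem i,
    smul_smul, sq]

/-- If `z ∈ K` annihilates `y`, then it annihilates `y ∘ y`. -/
theorem jmul_sq_eq_zero_of_mem_K {z y : E} (hz : z ∈ J.K) (hzy : J.jmul z y = 0) :
    J.jmul z (J.jmul y y) = 0 := by
  obtain ⟨c, τ, hc, rfl⟩ := exists_eq_sum_sq_smul_of_mem_K hz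
  have hsum : ∑ i, τ i ^ 2 * ⟪J.jmul (c i) y, y⟫ = 0 := by
    have hinner := congrArg (fun u => ⟪u, y⟫) hzy
    simpa [LinearMap.sum_apply, sum_inner, real_inner_smul_left] using hinner
  have hterm := (Finset.sum_eq_zero_iff_of_nonneg fun i _ =>
    mul_nonneg (sq_nonneg (τ i)) ((hc i).inner_jmul_nonneg y)).1 hsum
  simp only [map_sum, map_smul, LinearMap.sum_apply, LinearMap.smul_apply]
  refine Finset.sum_eq_zero fun i hi => ?_
  rcases mul_eq_zero.1 (hterm i hi) with hτ | hcy
  · rw [hτ, zero_smul]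
  · rw [(hc i).jmul_sq_eq_zero ((hc i).jmul_eq_zero_of_inner_eq_zero hcy), smul_zero]

end EJA

/-- a KKT quadruple of (P2) whose multiplier `λ` lies in `K`
yields a KKT triple of (P1). -/
theorem stmt8 {E : Type*} [NormedAddCommGroup E] [InnerProductSpace ℝ E]
    [FiniteDimensional ℝ E] (J : EJA E) {n m : ℕ}
    (f : EuclideanSpace ℝ (Fin n) → ℝ)
    (h : EuclideanSpace ℝ (Fin n) → EuclideanSpace ℝ (Fin m))
    (g : EuclideanSpace ℝ (Fin n) → E)
    (hf : ContDiff ℝ 2 f) (hh : ContDiff ℝ 2 h) (hg : ContDiff ℝ 2 g)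
    (x : EuclideanSpace ℝ (Fin n)) (y : E)
    (μ : EuclideanSpace ℝ (Fin m)) (lam : E)
    (hKKT : J.KKTP2 f h g x y μ lam) (hlam : lam ∈ J.K) :
    J.KKTP1 f h g x μ lam := by
  obtain ⟨hgrad, hly, hgx, hhx⟩ := hKKT
  refine ⟨hgrad, hlam, ⟨y, hgx⟩, ?_, hhx⟩
  rw [hgx]
  exact EJA.jmul_sq_eq_zero_of_mem_K hlam hly
end
end

section
/- Let z ∈ K have spectral decomposition z = Σ_{i=1}^{rank z} σ_i c_i with σ_1, …, σ_{rank z} > 0, with respect to a Jordan frame c_1, …, c_r, and set c = c_1 + ⋯ + c_{rank z}. Then {w ∈ K : ⟨w, z⟩ = 0} = {y∘y : y ∈ V(c,0)}, where V(c,0) = {w ∈ E : c∘w = 0}; that is, the conjugate face of the minimal face of K containing z is the cone of squares of the subalgebra V(c,0). -/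
open scoped RealInnerProductSpace

noncomputable section

namespace EJA

variable {E : Type*} [NormedAddCommGroup E] [InnerProductSpace ℝ E]
  [FiniteDimensional ℝ E]

/-- The Jordan identity, linearized in its repeated variable. -/
theorem jordan_linearized_s11 (J : EJA E) (a b z : E) :
    J.jmul b (J.jmul (J.jmul a a) z) + (2 : ℝ) • J.jmul a (J.jmul (J.jmul a b) z) =
      (2 : ℝ) • J.jmul (J.jmul a b) (J.jmul a z) + J.jmul (J.jmul a a) (J.jmul b z) := by
  have hplus := J.jordan (a + b) z
  have hminus := J.jordan (a - b) z
  have hb := J.jordan b z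
  simp only [map_add, map_sub, LinearMap.add_apply, LinearMap.sub_apply, J.comm b a]
    at hplus hminus
  linear_combination (norm := module) (1 / 2 : ℝ) • hplus - (1 / 2 : ℝ) • hminus - hb

/-- Multiplication by an idempotent is annihilated by `2 X ^ 3 - 3 X ^ 2 + X`. -/
theorem IsIdempotent.peirce_polynomial {J : EJA E} {c : E} (hc : J.IsIdempotent c) (y : E) :
    (2 : ℝ) • J.jmul c (J.jmul c (J.jmul c y)) + J.jmul c y =
      (3 : ℝ) • J.jmul c (J.jmul c y) := by
  have hc' : J.jmul c c = c := hc
  have h := J.jordan_linearized_s11 c y c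
  rw [hc', hc', J.comm y c, J.comm (J.jmul c y) c] at h
  linear_combination (norm := module) h

/-- The quadratic form of multiplication by an idempotent, as a sum of squares. -/
theorem IsIdempotent.inner_jmul_self {J : EJA E} {c : E} (hc : J.IsIdempotent c) (y : E) :
    ⟪y, J.jmul c y⟫ =
      ‖(2 : ℝ) • J.jmul c (J.jmul c y) - J.jmul c y‖ ^ 2 +
        8 * ‖J.jmul c y - J.jmul c (J.jmul c y)‖ ^ 2 := by
  have symm (a b : E) : ⟪J.jmul c a, b⟫ = ⟪a, J.jmul c b⟫ := by
    rw [J.comm c a, J.assoc_inner]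
  have h1 := congrArg (fun v => ⟪y, v⟫) (hc.peirce_polynomial y)
  have h2 := congrArg (fun v => ⟪y, J.jmul c v⟫) (hc.peirce_polynomial y)
  simp only [map_add, map_smul, inner_add_right, inner_smul_right] at h1 h2
  simp only [← real_inner_self_eq_norm_sq, inner_sub_left, inner_sub_right, inner_smul_left,
    inner_smul_right, symm, RCLike.conj_to_real]
  linear_combination h1 - 6 * h2

theorem IsIdempotent.inner_jmul_self_nonneg {J : EJA E} {c : E} (hc : J.IsIdempotent c)
    (y : E) : 0 ≤ ⟪y, J.jmul c y⟫ := by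
  rw [hc.inner_jmul_self]
  positivity

theorem IsIdempotent.inner_jmul_self_eq_zero_iff {J : EJA E} {c : E} (hc : J.IsIdempotent c)
    {y : E} : ⟪y, J.jmul c y⟫ = 0 ↔ J.jmul c y = 0 := by
  refine ⟨fun h => ?_, fun h => by rw [h, inner_zero_right]⟩
  rw [hc.inner_jmul_self] at h
  have hone : (2 : ℝ) • J.jmul c (J.jmul c y) - J.jmul c y = 0 := by
    rw [← norm_eq_zero, ← sq_eq_zero_iff]
    nlinarith [sq_nonneg ‖(2 : ℝ) • J.jmul c (J.jmul c y) - J.jmul c y‖,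
      sq_nonneg ‖J.jmul c y - J.jmul c (J.jmul c y)‖]
  have hhalf : J.jmul c y - J.jmul c (J.jmul c y) = 0 := by
    rw [← norm_eq_zero, ← sq_eq_zero_iff]
    nlinarith [sq_nonneg ‖(2 : ℝ) • J.jmul c (J.jmul c y) - J.jmul c y‖,
      sq_nonneg ‖J.jmul c y - J.jmul c (J.jmul c y)‖]
  linear_combination (norm := module) hone + (2 : ℝ) • hhalf

/-- A nonnegative combination of idempotents, with positive coefficients exactly on `s`, is
orthogonal to `y ∘ y` if and only if the sum of the idempotents over `s` annihilates `y`. -/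
theorem inner_square_sum_eq_zero_iff (J : EJA E) {ι : Type*} (s : Finset ι) {c : ι → E}
    {σ : ι → ℝ} (hc : ∀ i ∈ s, J.IsIdempotent (c i)) (hσ : ∀ i ∈ s, 0 < σ i) (y : E) :
    ⟪J.jmul y y, ∑ i ∈ s, σ i • c i⟫ = 0 ↔ ∀ i ∈ s, J.jmul (c i) y = 0 := by
  simp only [J.assoc_inner, J.comm y, map_sum, map_smul, LinearMap.sum_apply,
    LinearMap.smul_apply, inner_sum, inner_smul_right]
  rw [Finset.sum_eq_zero_iff_of_nonneg fun i hi =>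
    mul_nonneg (hσ i hi).le ((hc i hi).inner_jmul_self_nonneg y)]
  refine forall₂_congr fun i hi => ?_
  rw [mul_eq_zero, or_iff_right (hσ i hi).ne', (hc i hi).inner_jmul_self_eq_zero_iff]

/-- A sum of idempotents annihilates `y` if and only if each of them does. -/
theorem sum_jmul_eq_zero_iff (J : EJA E) {ι : Type*} (s : Finset ι) {c : ι → E}
    (hc : ∀ i ∈ s, J.IsIdempotent (c i)) (y : E) :
    J.jmul (∑ i ∈ s, c i) y = 0 ↔ ∀ i ∈ s, J.jmul (c i) y = 0 := by
  refine ⟨fun h => ?_, fun h => ?_⟩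
  · rw [← J.inner_square_sum_eq_zero_iff s (σ := fun _ => 1) hc fun _ _ => one_pos]
    simp only [one_smul]
    rw [J.assoc_inner, J.comm y, h, inner_zero_right]
  · rw [map_sum, LinearMap.sum_apply]
    exact Finset.sum_eq_zero h

end EJA

/-- the conjugate face `K ∩ {z}^⊥` of the minimal face of `K`
containing `z` is the cone of squares of the Peirce subalgebra `V(c, 0)`,
where `c` is the sum of the idempotents corresponding to the nonzero
eigenvalues of `z`. -/
theorem stmt11 {E : Type*} [NormedAddCommGroup E] [InnerProductSpace ℝ E]
    [FiniteDimensional ℝ E] (J : EJA E) (z : E)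
    (c : Fin J.rank → E) (σ : Fin J.rank → ℝ)
    (hc : J.IsJordanFrame c) (hz : z = ∑ i, σ i • c i)
    (k : ℕ) (hkr : k ≤ J.rank)
    (hpos : ∀ i : Fin J.rank, (i : ℕ) < k → 0 < σ i)
    (hzero : ∀ i : Fin J.rank, k ≤ (i : ℕ) → σ i = 0)
    (cc : E)
    (hcc : cc = ∑ i ∈ Finset.univ.filter (fun i : Fin J.rank => (i : ℕ) < k), c i) :
    {w : E | w ∈ J.K ∧ ⟪w, z⟫ = 0} =
      {w : E | ∃ u : E, J.jmul cc u = 0 ∧ w = J.jmul u u} := by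
  have hidem : ∀ i ∈ Finset.univ.filter (fun i : Fin J.rank => (i : ℕ) < k),
      J.IsIdempotent (c i) := fun i _ => (hc.1 i).1
  have hz' : z = ∑ i ∈ Finset.univ.filter (fun i : Fin J.rank => (i : ℕ) < k), σ i • c i := by
    rw [hz, Finset.sum_filter_of_ne]
    intro i _ hi
    by_contra hik
    exact hi (by rw [hzero i (not_lt.mp hik), zero_smul])
  have key (y : E) : ⟪J.jmul y y, z⟫ = 0 ↔ J.jmul cc y = 0 := by
    rw [hz', hcc, J.sum_jmul_eq_zero_iff _ hidem,
      J.inner_square_sum_eq_zero_iff _ hidem fun i hi => hpos i (Finset.mem_filter.mp hi).2]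
  ext w
  constructor
  · rintro ⟨⟨y, rfl⟩, hw⟩
    exact ⟨y, (key y).mp hw, rfl⟩
  · rintro ⟨u, hu, rfl⟩
    exact ⟨⟨u, rfl⟩, (key u).mpr hu⟩
end
end
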